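/- Let q be a real number with 0 < q < 1 and N a positive integer. Let A be the 2N×2N skew-symmetric matrix with entries a_{i,j} = (q^i - q^j) (q;q²)_{(i+j-1)/2} when i + j is odd, and a_{i,j} = 0 when i + j is even, for 0 ≤ i, j ≤ 2N-1. Then Pf(A) = q^{N(N-1)(4N-5)/6} ∏_{k=0}^{N-1} (q;q)_{2k+1}. (This is the Catalan–Hankel Pfaffian evaluation attached to the discrete q-Hermite I moments, obtained from the Al-Salam–Carlitz I case at a = -1.) -/

import Mathlib

open scoped BigOperators

/-- The finite q-Pochhammer symbol `(a;q)_n = ∏_{k=0}^{n-1} (1 - a q^k)`. -/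
noncomputable def qPoch (a q : ℝ) (n : ℕ) : ℝ := ∏ k ∈ Finset.range n, (1 - a * q ^ k)

/-- The Pfaffian of a `2N × 2N` real matrix, defined by
`Pf(A) = (1/(2^N N!)) ∑_{σ ∈ S_{2N}} sgn(σ) ∏_{k=1}^{N} a_{σ(2k-1),σ(2k)}`. -/
noncomputable def pfaffian {N : ℕ} (A : Matrix (Fin (2 * N)) (Fin (2 * N)) ℝ) : ℝ :=
  (1 / (2 ^ N * (Nat.factorial N : ℝ))) *
    ∑ σ : Equiv.Perm (Fin (2 * N)),
      ((Equiv.Perm.sign σ : ℤ) : ℝ) *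
        ∏ k : Fin N,
          A (σ ⟨2 * (k : ℕ), by have := k.isLt; omega⟩)
            (σ ⟨2 * (k : ℕ) + 1, by have := k.isLt; omega⟩)

open Finset Equiv Polynomial

section BipartitePfaffian

/-- The equivalence `(k, b) ↦ 2 k + b`, with `false` read as `0` and `true` as `1`. -/
def finProdBoolEquiv (N : ℕ) : Fin N × Bool ≃ Fin (2 * N) :=
  ((Equiv.refl _).prodCongr finTwoEquiv.symm).trans
    (finProdFinEquiv.trans (finCongr (mul_comm N 2)))

lemma finProdBoolEquiv_false {N : ℕ} (k : Fin N) :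
    finProdBoolEquiv N (k, false) = ⟨2 * (k : ℕ), by have := k.isLt; omega⟩ := by
  ext
  simp [finProdBoolEquiv, finTwoEquiv]

lemma finProdBoolEquiv_true {N : ℕ} (k : Fin N) :
    finProdBoolEquiv N (k, true) = ⟨2 * (k : ℕ) + 1, by have := k.isLt; omega⟩ := by
  ext
  simp [finProdBoolEquiv, finTwoEquiv, add_comm]

variable {n : Type*}

/-- The permutation of `n × Bool` that first permutes every pair `{(k, false), (k, true)}`
by `x.2 k`, and then the points with second coordinate `b` by `x.1 b`. -/
def pairPerm (x : (Bool → Perm n) × (n → Perm Bool)) : Perm (n × Bool) :=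
  (prodCongrRight x.2).trans (prodCongrLeft x.1)

lemma pairPerm_apply (x : (Bool → Perm n) × (n → Perm Bool)) (k : n) (b : Bool) :
    pairPerm x (k, b) = (x.1 (x.2 k b) k, x.2 k b) := rfl

lemma pairPerm_injective : Function.Injective (pairPerm (n := n)) := by
  rintro ⟨ρ, ε⟩ ⟨ρ', ε'⟩ h
  have key (k b) : ρ (ε k b) k = ρ' (ε' k b) k ∧ ε k b = ε' k b := by
    simpa [pairPerm_apply] using congrArg (fun σ : Perm (n × Bool) => σ (k, b)) h
  have hε : ε = ε' := by
    ext k b : 2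
    exact (key k b).2
  subst hε
  have hρ : ρ = ρ' := by
    ext b k : 2
    simpa using (key k ((ε k).symm b)).1
  rw [hρ]

lemma exists_pairPerm_eq [Finite n] (σ : Perm (n × Bool))
    (h : ∀ k, (σ (k, false)).2 ≠ (σ (k, true)).2) : ∃ x, pairPerm x = σ := by
  have hε (k : n) : Function.Bijective fun b => (σ (k, b)).2 := by
    rw [← Finite.injective_iff_bijective]
    have := h k
    rintro (_ | _) (_ | _) hb <;> simp_all
  let ε (k : n) : Perm Bool := Equiv.ofBijective _ (hε k)
  have hεσ (k b) : ε k b = (σ (k, b)).2 := rfl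
  have hρ (b : Bool) : Function.Bijective fun k => (σ (k, (ε k).symm b)).1 := by
    rw [← Finite.injective_iff_bijective]
    intro k l hkl
    have h2 : (σ (k, (ε k).symm b)).2 = (σ (l, (ε l).symm b)).2 := by
      rw [← hεσ, ← hεσ, Equiv.apply_symm_apply, Equiv.apply_symm_apply]
    exact congrArg Prod.fst (σ.injective (Prod.ext hkl h2))
  refine ⟨(fun b => Equiv.ofBijective _ (hρ b), ε), ?_⟩
  ext ⟨k, b⟩ : 1
  rw [pairPerm_apply]
  refine Prod.ext ?_ (hεσ k b)
  simp

lemma sign_pairPerm [Fintype n] [DecidableEq n] (x : (Bool → Perm n) × (n → Perm Bool)) :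
    Perm.sign (pairPerm x) =
      Perm.sign (x.1 false) * Perm.sign (x.1 true) * ∏ k, Perm.sign (x.2 k) := by
  have : pairPerm x = (prodCongrLeft x.1 : Perm (n × Bool)) * prodCongrRight x.2 := rfl
  rw [this, Perm.sign_mul, Perm.sign_prodCongrLeft, Perm.sign_prodCongrRight, Fintype.prod_bool,
    mul_comm (Perm.sign (x.1 true))]

lemma sum_sign_mul_sign_mul_prod [Fintype n] [DecidableEq n] {R : Type*} [CommRing R]
    (M : Matrix n n R) :
    ∑ τ : Perm n, ∑ π : Perm n, ((Perm.sign τ : ℤ) : R) * ((Perm.sign π : ℤ) : R) *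
      ∏ k, M (τ k) (π k) = (Fintype.card n).factorial * M.det := by
  have inner (π : Perm n) : ∑ τ : Perm n, ((Perm.sign τ : ℤ) : R) * ((Perm.sign π : ℤ) : R) *
      ∏ k, M (τ k) (π k) = M.det := by
    have h := M.det_permute' π
    rw [Matrix.det_apply'] at h
    have hs : ((Perm.sign π : ℤ) : R) * ((Perm.sign π : ℤ) : R) = 1 := by
      rw [← Int.cast_mul, ← Units.val_mul, Int.units_mul_self]; simp
    calc _ = ((Perm.sign π : ℤ) : R) * ∑ τ : Perm n, ((Perm.sign τ : ℤ) : R) *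
          ∏ k, M.submatrix id π (τ k) k := by
          rw [mul_sum]
          refine sum_congr rfl fun τ _ => ?_
          simp only [Matrix.submatrix_apply, id]
          ring
      _ = M.det := by rw [h, ← mul_assoc, hs, one_mul]
  rw [sum_comm, sum_congr rfl fun π _ => inner π]
  simp [Fintype.card_perm]

lemma sum_sign_mul_prod_of_bipartite [Fintype n] [DecidableEq n] {R : Type*} [CommRing R]
    (B : n × Bool → n × Bool → R) (hskew : ∀ x y, B y x = -B x y)
    (hzero : ∀ x y, x.2 = y.2 → B x y = 0) :
    ∑ σ : Perm (n × Bool), ((Perm.sign σ : ℤ) : R) * ∏ k, B (σ (k, false)) (σ (k, true)) =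
      2 ^ Fintype.card n * (Fintype.card n).factorial *
        (Matrix.of fun r s => B (r, false) (s, true)).det := by
  have hflip (ρ : Bool → Perm n) (e : Perm Bool) (k : n) : ((Perm.sign e : ℤ) : R) *
      B (ρ (e false) k, e false) (ρ (e true) k, e true) =
        B (ρ false k, false) (ρ true k, true) := by
    have he : e = 1 ∨ e = swap false true := by
      revert e
      decide
    rcases he with rfl | rfl
    · simp
    · simp [hskew (ρ false k, false) (ρ true k, true)]
  have hterm (x : (Bool → Perm n) × (n → Perm Bool)) :
      ((Perm.sign (x.1 false) : ℤ) : R) * ((Perm.sign (x.1 true) : ℤ) : R) *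
        ∏ k, B (x.1 false k, false) (x.1 true k, true) =
      ((Perm.sign (pairPerm x) : ℤ) : R) *
        ∏ k, B (pairPerm x (k, false)) (pairPerm x (k, true)) := by
    rw [prod_congr rfl fun k _ => (hflip x.1 (x.2 k) k).symm, prod_mul_distrib, sign_pairPerm]
    simp only [pairPerm_apply]
    push_cast
    ring
  rw [← sum_of_injOn pairPerm pairPerm_injective.injOn (s := univ) (by simp) ?_
    fun x _ => hterm x]
  · rw [Fintype.sum_prod_type, ← (boolArrowEquivProd (Perm n)).symm.sum_comp,
      Fintype.sum_prod_type, mul_assoc, ← sum_sign_mul_sign_mul_prod, mul_sum]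
    refine sum_congr rfl fun τ _ => ?_
    rw [mul_sum]
    refine sum_congr rfl fun π _ => ?_
    simp [Fintype.card_perm, boolArrowEquivProd]
  · intro σ _ hσ
    by_contra hne
    refine hσ ?_
    obtain ⟨x, hx⟩ := exists_pairPerm_eq σ fun k hk =>
      hne (by rw [prod_eq_zero (mem_univ k) (hzero _ _ hk), mul_zero])
    exact ⟨x, by simp, hx⟩

/-- A Pfaffian whose entries vanish unless the indices have opposite parity is the determinant
of its block of even rows and odd columns. -/
theorem pfaffian_eq_det_of_bipartite {N : ℕ} (A : Matrix (Fin (2 * N)) (Fin (2 * N)) ℝ)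
    (hskew : ∀ i j, A j i = -A i j) (hzero : ∀ i j : Fin (2 * N), Even ((i : ℕ) + (j : ℕ)) → A i j = 0) :
    pfaffian A = (Matrix.of fun r s : Fin N =>
      A ⟨2 * (r : ℕ), by have := r.isLt; omega⟩
        ⟨2 * (s : ℕ) + 1, by have := s.isLt; omega⟩).det := by
  let e := finProdBoolEquiv N
  have h := sum_sign_mul_prod_of_bipartite (fun x y => A (e x) (e y)) (fun x y => hskew _ _) (by
    rintro ⟨k, a⟩ ⟨l, b⟩ (rfl : a = b)
    refine hzero _ _ ?_
    cases a
    · simp only [e, finProdBoolEquiv_false]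
      exact ⟨k + l, by ring⟩
    · simp only [e, finProdBoolEquiv_true]
      exact ⟨k + l + 1, by ring⟩)
  have hsum : ∑ σ : Perm (Fin (2 * N)), ((Perm.sign σ : ℤ) : ℝ) *
      ∏ k : Fin N, A (σ ⟨2 * (k : ℕ), by have := k.isLt; omega⟩)
        (σ ⟨2 * (k : ℕ) + 1, by have := k.isLt; omega⟩) =
      ∑ σ : Perm (Fin N × Bool), ((Perm.sign σ : ℤ) : ℝ) *
        ∏ k, A (e (σ (k, false))) (e (σ (k, true))) := by
    rw [← e.permCongr.sum_comp]
    refine sum_congr rfl fun σ _ => ?_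
    simp only [Perm.sign_permCongr, ← finProdBoolEquiv_false, ← finProdBoolEquiv_true,
      Equiv.permCongr_apply, e, Equiv.symm_apply_apply]
  rw [pfaffian, hsum, h, Fintype.card_fin]
  simp only [e, finProdBoolEquiv_false, finProdBoolEquiv_true]
  field_simp

end BipartitePfaffian

section Determinant

lemma Fin.prod_prod_Ioi_eq_prod_range {M : Type*} [CommMonoid M] (N : ℕ) (f : ℕ → ℕ → M) :
    ∏ i : Fin N, ∏ j ∈ Ioi i, f i j = ∏ j ∈ range N, ∏ i ∈ range j, f i j := by
  rw [prod_comm' (t' := univ) (s' := fun j => Iio j) (by simp),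
    ← Fin.prod_univ_eq_prod_range (fun j => ∏ i ∈ range j, f i j)]
  refine prod_congr rfl fun j _ => ?_
  rw [← Nat.Iio_eq_range, ← Fin.map_valEmbedding_Iio, prod_map]
  rfl

/-- The monic polynomial in `x` proportional to `(p ^ r - x) (x; p)_r / (1 - x)`. -/
noncomputable def shiftedPochPoly (p : ℝ) : ℕ → ℝ[X]
  | 0 => 1
  | r + 1 => (X - C (p ^ (r + 1))) * ∏ i ∈ range r, (X - C (p ^ (i + 1))⁻¹)

lemma shiftedPochPoly_monic (p : ℝ) (r : ℕ) : (shiftedPochPoly p r).Monic := by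
  cases r with
  | zero => exact monic_one
  | succ r => exact (monic_X_sub_C _).mul (monic_prod_of_monic _ _ fun i _ => monic_X_sub_C _)

lemma shiftedPochPoly_natDegree (p : ℝ) (r : ℕ) : (shiftedPochPoly p r).natDegree = r := by
  cases r with
  | zero => exact natDegree_one
  | succ r =>
    rw [shiftedPochPoly, (monic_X_sub_C _).natDegree_mul
      (monic_prod_of_monic _ _ fun i _ => monic_X_sub_C _),
      natDegree_prod_of_monic _ _ fun i _ => monic_X_sub_C _]
    simp only [natDegree_X_sub_C, sum_const, card_range, smul_eq_mul, mul_one, add_comm]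

lemma qPoch_add (a q : ℝ) (m n : ℕ) :
    qPoch a q (m + n) = qPoch a q m * ∏ i ∈ range n, (1 - a * q ^ (m + i)) :=
  prod_range_add _ _ _

lemma sub_mul_qPoch_eq {p : ℝ} (hp : p ≠ 0) (a : ℝ) (r s : ℕ) :
    (p ^ r - a * p ^ s) * qPoch a p (r + s) =
      (∏ i ∈ range r, -p ^ i) *
        (qPoch a p (s + 1) * (shiftedPochPoly p r).eval (a * p ^ s)) := by
  cases r with
  | zero => simp [shiftedPochPoly, qPoch, prod_range_succ, mul_comm]
  | succ r =>
    have h : ∏ i ∈ range r, (1 - a * p ^ (s + 1 + i)) =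
        (∏ i ∈ range r, -p ^ (i + 1)) * ∏ i ∈ range r, (a * p ^ s - (p ^ (i + 1))⁻¹) := by
      rw [← prod_mul_distrib]
      refine prod_congr rfl fun i _ => ?_
      field_simp
      ring
    rw [show r + 1 + s = s + 1 + r by ring, qPoch_add, h, prod_range_succ', shiftedPochPoly]
    simp only [eval_mul, eval_prod, eval_sub, eval_X, eval_C]
    ring

lemma det_sub_mul_qPoch {p : ℝ} (hp : p ≠ 0) (a : ℝ) (N : ℕ) :
    (Matrix.of fun r s : Fin N =>
      (p ^ (r : ℕ) - a * p ^ (s : ℕ)) * qPoch a p ((r : ℕ) + (s : ℕ))).det =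
      ∏ k ∈ range N, (qPoch a p (k + 1) * ∏ i ∈ range k, -p ^ i * (a * p ^ k - a * p ^ i)) := by
  simp only [sub_mul_qPoch_eq hp]
  have hV := Matrix.det_eval_matrixOfPolynomials_eq_det_vandermonde
    (fun s : Fin N => a * p ^ (s : ℕ)) (fun r => shiftedPochPoly p r)
    (fun r => shiftedPochPoly_natDegree p r) fun r => shiftedPochPoly_monic p r
  rw [← Matrix.det_transpose (Matrix.of _), Matrix.det_vandermonde,
    Fin.prod_prod_Ioi_eq_prod_range N fun i j => a * p ^ j - a * p ^ i] at hV
  have h1 := Matrix.det_mul_column (fun r : Fin N => ∏ i ∈ range (r : ℕ), -p ^ i)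
    (Matrix.of fun r s : Fin N => qPoch a p (s + 1) * (shiftedPochPoly p r).eval (a * p ^ (s : ℕ)))
  have h2 := Matrix.det_mul_row (fun s : Fin N => qPoch a p (s + 1))
    (Matrix.of fun r s : Fin N => (shiftedPochPoly p r).eval (a * p ^ (s : ℕ)))
  simp only [Matrix.of_apply] at h1 h2
  have hT : (Matrix.of fun r s : Fin N => (shiftedPochPoly p r).eval (a * p ^ (s : ℕ))) =
      (Matrix.of fun s r : Fin N => (shiftedPochPoly p r).eval (a * p ^ (s : ℕ))).transpose := rfl
  rw [h1, h2, hT, ← hV, Fin.prod_univ_eq_prod_range (fun r => ∏ i ∈ range r, -p ^ i),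
    Fin.prod_univ_eq_prod_range (fun s => qPoch a p (s + 1))]
  simp only [prod_mul_distrib]
  ring

end Determinant

lemma qPoch_self_two_mul_add_one (q : ℝ) (k : ℕ) :
    qPoch q q (2 * k + 1) =
      qPoch q (q ^ 2) (k + 1) * ∏ i ∈ range k, (1 - (q ^ 2) ^ (i + 1)) := by
  induction k with
  | zero => simp [qPoch]
  | succ k ih =>
    have h1 : qPoch q q (2 * (k + 1) + 1) =
        qPoch q q (2 * k + 1) * (1 - q * q ^ (2 * k + 1)) * (1 - q * q ^ (2 * k + 2)) := by
      simp only [qPoch, mul_add, mul_one, prod_range_succ]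
    have h2 : qPoch q (q ^ 2) (k + 1 + 1) =
        qPoch q (q ^ 2) (k + 1) * (1 - q * (q ^ 2) ^ (k + 1)) := prod_range_succ _ _
    rw [h1, h2, ih, prod_range_succ]
    ring

lemma qPoch_mul_prod_eq_pow_mul_qPoch (q : ℝ) (k : ℕ) :
    qPoch q (q ^ 2) (k + 1) *
        ∏ i ∈ range k, -(q ^ 2) ^ i * (q * (q ^ 2) ^ k - q * (q ^ 2) ^ i) =
      q ^ (k * (2 * k - 1)) * qPoch q q (2 * k + 1) := by
  have h : ∏ i ∈ range k, -(q ^ 2) ^ i * (q * (q ^ 2) ^ k - q * (q ^ 2) ^ i) =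
      ∏ i ∈ range k, q ^ (4 * i + 1) * (1 - (q ^ 2) ^ (k - 1 - i + 1)) := by
    refine prod_congr rfl fun i hi => ?_
    obtain ⟨d, rfl⟩ := Nat.exists_eq_add_of_lt (mem_range.mp hi)
    rw [show i + d + 1 - 1 - i + 1 = d + 1 by omega]
    ring
  have hexp : ∑ i ∈ range k, (4 * i + 1) = k * (2 * k - 1) := by
    clear h
    induction k with
    | zero => rfl
    | succ k ih =>
      rw [sum_range_succ, ih]
      cases k with
      | zero => rfl
      | succ k =>
        rw [show 2 * (k + 1) - 1 = 2 * k + 1 by omega,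
          show 2 * (k + 1 + 1) - 1 = 2 * k + 3 by omega]
        ring
  rw [h, prod_mul_distrib, prod_pow_eq_pow_sum, hexp,
    prod_range_reflect (fun i => 1 - (q ^ 2) ^ (i + 1)), qPoch_self_two_mul_add_one]
  ring

lemma prod_pow_eq_rpow {q : ℝ} (hq : 0 < q) (N : ℕ) :
    ∏ k ∈ range N, q ^ (k * (2 * k - 1)) =
      q ^ ((N : ℝ) * ((N : ℝ) - 1) * (4 * (N : ℝ) - 5) / 6) := by
  induction N with
  | zero => simp
  | succ N ih =>
    rw [prod_range_succ, ih, ← Real.rpow_natCast, ← Real.rpow_add hq]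
    congr 1
    cases N with
    | zero => simp
    | succ N =>
      rw [show 2 * (N + 1) - 1 = 2 * N + 1 by omega]
      push_cast
      ring

theorem pfaffian_qHermiteI (q : ℝ) (hq0 : 0 < q) (hq1 : q < 1) (N : ℕ) (hN : 0 < N) :
    pfaffian (fun i j : Fin (2 * N) =>
        if Odd ((i : ℕ) + (j : ℕ)) then
          (q ^ (i : ℕ) - q ^ (j : ℕ)) * qPoch q (q ^ 2) (((i : ℕ) + (j : ℕ) - 1) / 2)
        else 0) =
      q ^ ((N : ℝ) * ((N : ℝ) - 1) * (4 * (N : ℝ) - 5) / 6) *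
        ∏ k ∈ Finset.range N, qPoch q q (2 * k + 1) := by
  refine (pfaffian_eq_det_of_bipartite _ (fun i j => ?_)
    fun i j h => if_neg (Nat.not_odd_iff_even.mpr h)).trans ?_
  · simp only [add_comm (j : ℕ)]
    split_ifs <;> ring
  · rw [← prod_pow_eq_rpow hq0, ← prod_mul_distrib,
      ← prod_congr rfl fun k _ => qPoch_mul_prod_eq_pow_mul_qPoch q k,
      ← det_sub_mul_qPoch (pow_ne_zero 2 hq0.ne') q N]
    congr 1
    ext r s
    simp only [Matrix.of_apply]
    rw [if_pos ⟨(r : ℕ) + s, by ring⟩,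
      show (2 * (r : ℕ) + (2 * (s : ℕ) + 1) - 1) / 2 = r + s by omega]
    ring
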